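/- Let F be a field, V an F-vector space, and Π a subspace of V*. Consider the point set of Γ(V,Π): the pairs (p,H) with p a 1-dimensional subspace of V and H = ker φ for some nonzero φ ∈ Π with p ⊆ H; call two distinct points collinear if they lie on a common line of Γ(V,Π). Let S be a set of points of Γ(V,Π) that contains at least two distinct points and is pairwise collinear (any two distinct points of S are collinear). Then exactly one of the following holds: there is a 1-dimensional subspace p of V such that every point in S has first coordinate p, or there is a hyperplane H such that every point in S has second coordinate H. (Equivalently: every clique of size at least 2 in the collinearity graph of Γ(V,Π) is contained in a unique maximal clique of the form p̄ = {points with first coordinate p} or H̄ = {points with second coordinate H}.) -/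

import Mathlib

/-- The point set of the geometry `Γ(V,Π)`: incident point–hyperplane pairs `(p, H)` with
`p` a 1-dimensional subspace of `V` and `H` the kernel of some nonzero `φ ∈ Π`. -/
def GammaPoint (F : Type*) [Field F] (V : Type*) [AddCommGroup V] [Module F V]
    (Pi : Submodule F (Module.Dual F V)) : Set (Submodule F V × Submodule F V) :=
  {x | Module.finrank F x.1 = 1 ∧ (∃ φ ∈ Pi, φ ≠ 0 ∧ x.2 = LinearMap.ker φ) ∧ x.1 ≤ x.2}

/-- The lines of the geometry `Γ(V,Π)`: either all points `(r, ker φ)` with `r` running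
over the 1-dimensional subspaces of a fixed 2-dimensional `W ≤ ker φ`, or all points
`(p, ker ψ)` with `ψ` running over the nonzero elements of a fixed 2-dimensional subspace
`Ψ` of `Π` all of whose elements vanish on `p`. -/
def IsGammaLine (F : Type*) [Field F] (V : Type*) [AddCommGroup V] [Module F V]
    (Pi : Submodule F (Module.Dual F V)) (L : Set (Submodule F V × Submodule F V)) : Prop :=
  (∃ (W : Submodule F V) (φ : Module.Dual F V), Module.finrank F W = 2 ∧ φ ∈ Pi ∧ φ ≠ 0 ∧
      W ≤ LinearMap.ker φ ∧
      L = {x | ∃ r : Submodule F V,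
            Module.finrank F r = 1 ∧ r ≤ W ∧ x = (r, LinearMap.ker φ)}) ∨
  (∃ (p : Submodule F V) (Psi : Submodule F (Module.Dual F V)), Module.finrank F p = 1 ∧
      Module.finrank F Psi = 2 ∧ Psi ≤ Pi ∧ (∀ ψ ∈ Psi, p ≤ LinearMap.ker ψ) ∧
      L = {x | ∃ ψ ∈ Psi, ψ ≠ 0 ∧ x = (p, LinearMap.ker ψ)})

/-- A set of pairs any two of which agree in some coordinate has a constant coordinate. -/
theorem Set.exists_forall_fst_eq_or_exists_forall_snd_eq {α β : Type*} {S : Set (α × β)}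
    (hne : S.Nonempty) (h : ∀ a ∈ S, ∀ b ∈ S, a.1 = b.1 ∨ a.2 = b.2) :
    (∃ p, ∀ x ∈ S, x.1 = p) ∨ ∃ q, ∀ x ∈ S, x.2 = q := by
  obtain ⟨a, ha⟩ := hne
  by_cases hfst : ∀ x ∈ S, x.1 = a.1
  · exact .inl ⟨a.1, hfst⟩
  push Not at hfst
  obtain ⟨b, hb, hba⟩ := hfst
  refine .inr ⟨a.2, fun x hx => ?_⟩
  have hba2 := (h b hb a ha).resolve_left hba
  rcases h x hx a ha with hxa | hxa
  · exact ((h x hx b hb).resolve_left fun hxb => hba (hxb.symm.trans hxa)).trans hba2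
  · exact hxa

/-- Two points on a common line of `Γ(V,Π)` share a coordinate. -/
theorem IsGammaLine.fst_eq_or_snd_eq {F : Type*} [Field F] {V : Type*} [AddCommGroup V]
    [Module F V] {Pi : Submodule F (Module.Dual F V)} {L : Set (Submodule F V × Submodule F V)}
    (hL : IsGammaLine F V Pi L) {a b : Submodule F V × Submodule F V} (ha : a ∈ L)
    (hb : b ∈ L) : a.1 = b.1 ∨ a.2 = b.2 := by
  rcases hL with ⟨W, φ, -, -, -, -, rfl⟩ | ⟨p, Psi, -, -, -, -, rfl⟩
  · obtain ⟨r, -, -, rfl⟩ := ha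
    obtain ⟨s, -, -, rfl⟩ := hb
    exact .inr rfl
  · obtain ⟨ψ, -, -, rfl⟩ := ha
    obtain ⟨χ, -, -, rfl⟩ := hb
    exact .inl rfl

/-- Every clique of size at least 2 in the collinearity graph of `Γ(V,Π)` consists of
points that all share their first coordinate, or all share their second coordinate —
and exactly one of the two alternatives occurs. -/
theorem clique_shares_point_or_hyperplane (F : Type*) [Field F] (V : Type*)
    [AddCommGroup V] [Module F V] (Pi : Submodule F (Module.Dual F V))
    (S : Set (Submodule F V × Submodule F V)) (hS : S ⊆ GammaPoint F V Pi)
    (hS2 : ∃ a ∈ S, ∃ b ∈ S, a ≠ b)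
    (hcol : ∀ a ∈ S, ∀ b ∈ S, a ≠ b →
      ∃ L, IsGammaLine F V Pi L ∧ a ∈ L ∧ b ∈ L) :
    Xor' (∃ p : Submodule F V, ∀ x ∈ S, x.1 = p)
      (∃ H : Submodule F V, ∀ x ∈ S, x.2 = H) := by
  obtain ⟨a, ha, b, hb, hab⟩ := hS2
  refine (xor_iff_or_and_not_and _ _).mpr ⟨?_, ?_⟩
  · refine Set.exists_forall_fst_eq_or_exists_forall_snd_eq ⟨a, ha⟩ fun x hx y hy => ?_
    by_cases hxy : x = y
    · exact .inl (congrArg Prod.fst hxy)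
    · obtain ⟨L, hL, hxL, hyL⟩ := hcol x hx y hy hxy
      exact hL.fst_eq_or_snd_eq hxL hyL
  · rintro ⟨⟨p, hp⟩, q, hq⟩
    exact hab (Prod.ext ((hp a ha).trans (hp b hb).symm) ((hq a ha).trans (hq b hb).symm))
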